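/- There exist two distinct extreme points B₁ and B₂ of the set 𝔅 of all Banach limits (a convex subset of the dual space of l_∞) such that |B₁(x) − B₂(x)| < 2 for every x ∈ l_∞ with ‖x‖_∞ ≤ 1. -/

import Mathlib

open BoundedContinuousFunction

/-- The right shift `S` on `l_∞ = ℕ →ᵇ ℝ`: `(Sx)_0 = 0`, `(Sx)_{n+1} = x_n`. -/
noncomputable def shiftR (x : ℕ →ᵇ ℝ) : ℕ →ᵇ ℝ :=
  BoundedContinuousFunction.ofNormedAddCommGroup
    (fun n => match n with
      | 0 => 0
      | m + 1 => x m)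
    (continuous_of_discreteTopology) ‖x‖
    (by
      intro n
      match n with
      | 0 => simp
      | m + 1 => simpa using x.norm_coe_le_norm m)

/-- A Banach limit, as an element of the continuous dual of `l_∞ = ℕ →ᵇ ℝ`:
positive, normalised at the constant sequence `𝟙`, and invariant under the right
shift.  (Every Banach limit is automatically norm-continuous, so no generality is
lost by working in the continuous dual.) -/
def IsBanachLimitD (B : (ℕ →ᵇ ℝ) →L[ℝ] ℝ) : Prop :=
  (∀ x : ℕ →ᵇ ℝ, (∀ n, 0 ≤ x n) → 0 ≤ B x) ∧
  B (BoundedContinuousFunction.const ℕ (1 : ℝ)) = 1 ∧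
  (∀ x : ℕ →ᵇ ℝ, B (shiftR x) = B x)


open Filter Topology

/-- Indicator of a set as a bounded sequence. -/
noncomputable def bInd (A : Set ℕ) : ℕ →ᵇ ℝ :=
  BoundedContinuousFunction.ofNormedAddCommGroup (A.indicator (fun _ => (1 : ℝ)))
    continuous_of_discreteTopology 1 (by
      intro n
      by_cases h : n ∈ A <;> simp [h])

lemma bInd_apply (A : Set ℕ) (n : ℕ) : bInd A n = A.indicator (fun _ => (1 : ℝ)) n := rfl

lemma bInd_mem {A : Set ℕ} {n : ℕ} (h : n ∈ A) : bInd A n = 1 := by simp [bInd_apply, h]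

lemma bInd_not_mem {A : Set ℕ} {n : ℕ} (h : n ∉ A) : bInd A n = 0 := by simp [bInd_apply, h]

lemma shiftR_succ (x : ℕ →ᵇ ℝ) (n : ℕ) : shiftR x (n + 1) = x n := rfl

lemma shiftR_zero (x : ℕ →ᵇ ℝ) : shiftR x 0 = 0 := rfl

/-- Window average. -/
noncomputable def wavg (x : ℕ →ᵇ ℝ) (s L : ℕ) : ℝ := (∑ i ∈ Finset.range L, x (s + i)) / L

lemma wavg_abs (x : ℕ →ᵇ ℝ) (s L : ℕ) : |wavg x s L| ≤ ‖x‖ := by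
  unfold wavg
  rcases Nat.eq_zero_or_pos L with h | h
  · subst h; simp
  · have hL : (0 : ℝ) < L := by exact_mod_cast h
    rw [abs_div, abs_of_pos hL, div_le_iff₀ hL]
    calc |∑ i ∈ Finset.range L, x (s + i)| ≤ ∑ i ∈ Finset.range L, |x (s + i)| :=
          Finset.abs_sum_le_sum_abs _ _
      _ ≤ ∑ i ∈ Finset.range L, ‖x‖ := Finset.sum_le_sum (fun i _ => x.norm_coe_le_norm _)
      _ = ‖x‖ * L := by simp [mul_comm]

lemma wavg_shift (x : ℕ →ᵇ ℝ) (s L : ℕ) :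
    |wavg (shiftR x) s L - wavg x s L| ≤ (2 * ‖x‖) / L := by
  unfold wavg
  rw [← sub_div, ← Finset.sum_sub_distrib]
  have h1 : ∀ i, shiftR x (s + i) - x (s + i)
      = (fun j => - shiftR x (s + j)) (i + 1) - (fun j => - shiftR x (s + j)) i := by
    intro i
    have : shiftR x (s + (i + 1)) = x (s + i) := rfl
    simp only [this]; ring
  rw [Finset.sum_congr rfl (fun i _ => h1 i),
    Finset.sum_range_sub (fun j => - shiftR x (s + j)), abs_div, Nat.abs_cast]
  apply div_le_div_of_nonneg_right _ (Nat.cast_nonneg L)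
  have hs : ∀ n, |shiftR x n| ≤ ‖x‖ := by
    intro n
    cases n with
    | zero => simp [shiftR_zero]
    | succ m => exact x.norm_coe_le_norm m
  have := abs_le.1 (hs (s + L))
  have := abs_le.1 (hs (s + 0))
  rw [abs_le]; constructor <;> linarith

lemma exists_limit (F : Filter ℕ) (l : ℕ → ℕ) (hl : Tendsto l atTop atTop) (hpos : ∀ k, 0 < l k)
    (good : ℕ → ℕ → Prop)
    (h : ∀ A ∈ F, ∀ K, ∃ k ≥ K, ∃ s, good s k ∧ ∀ i < l k, s + i ∈ A) :
    ∃ B : (ℕ →ᵇ ℝ) →L[ℝ] ℝ, IsBanachLimitD B ∧ (∀ A ∈ F, B (bInd A) = 1) ∧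
      ∀ (y : ℕ →ᵇ ℝ) (c : ℝ), (∀ s k, good s k → c ≤ wavg y s (l k)) → c ≤ B y := by
  let Φ : Filter (ℕ × ℕ) :=
    { sets := {U | ∃ A ∈ F, ∃ K, ∀ k ≥ K, ∀ s, good s k → (∀ i < l k, s + i ∈ A) → (s, k) ∈ U}
      univ_sets := ⟨Set.univ, univ_mem, 0, fun _ _ _ _ _ => trivial⟩
      sets_of_superset := by
        rintro U V ⟨A, hA, K, hK⟩ hUV
        exact ⟨A, hA, K, fun k hk s hs hi => hUV (hK k hk s hs hi)⟩
      inter_sets := by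
        rintro U V ⟨A, hA, K, hK⟩ ⟨A', hA', K', hK'⟩
        exact ⟨A ∩ A', inter_mem hA hA', max K K', fun k hk s hs hi =>
          ⟨hK k (le_trans (le_max_left _ _) hk) s hs fun i h => (hi i h).1,
           hK' k (le_trans (le_max_right _ _) hk) s hs fun i h => (hi i h).2⟩⟩ }
  have hΦ : ∀ U : Set (ℕ × ℕ), U ∈ Φ ↔ ∃ A ∈ F, ∃ K, ∀ k ≥ K, ∀ s, good s k →
      (∀ i < l k, s + i ∈ A) → (s, k) ∈ U := fun U => Iff.rfl
  have hne : Φ.NeBot := by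
    rw [← empty_mem_iff_bot.not.trans Iff.rfl |>.trans neBot_iff.symm]
    rw [hΦ]
    rintro ⟨A, hA, K, hK⟩
    obtain ⟨k, hk, s, hs, hi⟩ := h A hA K
    exact hK k hk s hs hi
  let V := Ultrafilter.of Φ
  have hV : (V : Filter (ℕ × ℕ)) ≤ Φ := Ultrafilter.of_le Φ
  have hex : ∀ x : ℕ →ᵇ ℝ, ∃ b, Tendsto (fun p : ℕ × ℕ => wavg x p.1 (l p.2)) V (𝓝 b) := by
    intro x
    obtain ⟨b, _, hb⟩ := (isCompact_Icc (a := -‖x‖) (b := ‖x‖)).ultrafilter_le_nhds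
      (V.map (fun p : ℕ × ℕ => wavg x p.1 (l p.2))) (by
        rw [le_principal_iff]
        exact Filter.mem_map.2 (Filter.univ_mem' fun p => abs_le.1 (wavg_abs x _ _)))
    exact ⟨b, hb⟩
  choose L hL using hex
  let B0 : (ℕ →ᵇ ℝ) →ₗ[ℝ] ℝ :=
    { toFun := L
      map_add' := fun x y => by
        refine tendsto_nhds_unique (hL (x + y)) (((hL x).add (hL y)).congr fun p => ?_)
        simp [wavg, Finset.sum_add_distrib, add_div]
      map_smul' := fun c x => by
        refine tendsto_nhds_unique (hL (c • x)) (((hL x).const_mul c).congr fun p => ?_)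
        simp only [wavg, BoundedContinuousFunction.coe_smul, smul_eq_mul]
        rw [← Finset.mul_sum, mul_div_assoc] }
  let B : (ℕ →ᵇ ℝ) →L[ℝ] ℝ := B0.mkContinuous 1 (fun x => by
    rw [one_mul]
    exact le_of_tendsto (hL x).abs (Eventually.of_forall fun p => wavg_abs x _ _))
  have hB : ∀ x, Tendsto (fun p : ℕ × ℕ => wavg x p.1 (l p.2)) V (𝓝 (B x)) := hL
  refine ⟨B, ⟨?_, ?_, ?_⟩, ?_, ?_⟩
  · intro x hx
    refine ge_of_tendsto (hB x) (Eventually.of_forall fun p => ?_)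
    exact div_nonneg (Finset.sum_nonneg fun i _ => hx _) (Nat.cast_nonneg _)
  · refine tendsto_nhds_unique (hB _) (tendsto_const_nhds.congr fun p => ?_)
    have : (l p.2 : ℝ) ≠ 0 := by exact_mod_cast (hpos p.2).ne'
    simp [wavg, this]
  · intro x
    have hk : Tendsto (fun p : ℕ × ℕ => (2 * ‖x‖) / (l p.2 : ℝ)) V (𝓝 0) := by
      have h2 : Tendsto (fun p : ℕ × ℕ => p.2) V atTop := by
        refine Tendsto.mono_left ?_ hV
        rw [tendsto_atTop]
        intro K
        exact (hΦ _).2 ⟨Set.univ, univ_mem, K, fun k hk s _ _ => hk⟩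
      exact Tendsto.const_div_atTop (tendsto_natCast_atTop_atTop.comp (hl.comp h2)) _
    have h0 := squeeze_zero_norm
      (f := fun p : ℕ × ℕ => wavg (shiftR x) p.1 (l p.2) - wavg x p.1 (l p.2))
      (fun p : ℕ × ℕ => wavg_shift x p.1 (l p.2)) hk
    exact sub_eq_zero.1 (tendsto_nhds_unique ((hB (shiftR x)).sub (hB x)) h0)
  · intro A hA
    refine tendsto_nhds_unique (hB _) (tendsto_const_nhds.congr' ?_)
    apply hV
    refine (hΦ _).2 ⟨A, hA, 0, fun k _ s _ hi => ?_⟩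
    have : (l k : ℝ) ≠ 0 := by exact_mod_cast (hpos k).ne'
    change (1 : ℝ) = wavg _ s (l k)
    unfold wavg
    rw [Finset.sum_congr rfl (fun i h => bInd_mem (hi i (Finset.mem_range.1 h)))]
    simp [this]
  · intro y c hc
    refine ge_of_tendsto (hB y) (hV ?_)
    exact (hΦ _).2 ⟨Set.univ, univ_mem, 0, fun k _ s hs _ => hc s k hs⟩

/-! ### The sequence -/

/-- Window lengths. -/
def wl : ℕ → ℕ
  | 0 => 1
  | k + 1 => wl k * 4 ^ (k + 1)

lemma wl_pos (k : ℕ) : 0 < wl k := by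
  induction k with
  | zero => simp [wl]
  | succ k ih => simp only [wl]; positivity

lemma wl_lt (k : ℕ) : wl k < wl (k + 1) := by
  have h := wl_pos k
  have : 1 < 4 ^ (k + 1) := Nat.one_lt_pow (by omega) (by omega)
  simp only [wl]; nlinarith

lemma wl_tendsto : Tendsto wl atTop atTop := (strictMono_nat_of_lt_succ wl_lt).tendsto_atTop

lemma wl_dvd {j k : ℕ} (h : j ≤ k) : wl j ∣ wl k := by
  induction h with
  | refl => exact dvd_rfl
  | step _ ih => exact ih.trans (Dvd.intro _ rfl)

/-- Level sets: the `j`-th mixed radix digit vanishes. -/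
def WW (j : ℕ) : Set ℕ := {n | n % wl (j + 1) < wl j}

/-- The set whose indicator has several Banach limits. -/
def AA : Set ℕ := {n | ∃ k, Even k ∧ n ∈ WW k ∧ ∀ j < k, n ∉ WW j}

lemma sum_WW (j t m : ℕ) :
    ∑ i ∈ Finset.range (wl (j + 1) * m), bInd (WW j) (wl (j + 1) * t + i) = wl j * m := by
  induction m with
  | zero => simp
  | succ m ih =>
    rw [mul_add, mul_one, Finset.sum_range_add, ih]
    have h1 : ∀ i ∈ Finset.range (wl (j + 1)),
        bInd (WW j) (wl (j + 1) * t + (wl (j + 1) * m + i)) = if i < wl j then 1 else 0 := by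
      intro i hi
      have hi := Finset.mem_range.1 hi
      have : (wl (j + 1) * t + (wl (j + 1) * m + i)) % wl (j + 1) = i := by
        rw [← add_assoc, ← mul_add, Nat.mul_add_mod, Nat.mod_eq_of_lt hi]
      simp [bInd_apply, Set.indicator, WW, this]
    rw [Finset.sum_congr rfl h1, Finset.sum_ite, Finset.sum_const_zero, Finset.sum_const]
    have : (Finset.range (wl (j + 1))).filter (fun i => i < wl j) = Finset.range (wl j) := by
      ext i; simp only [Finset.mem_filter, Finset.mem_range]
      have := wl_lt j
      omega
    rw [this]
    simp; ring

lemma sum_WW' {j k : ℕ} (h : j < k) (m : ℕ) :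
    ∑ i ∈ Finset.range (wl k), bInd (WW j) (wl (k + 1) * m + i) = wl k / 4 ^ (j + 1) := by
  obtain ⟨q, hq⟩ := wl_dvd (show j + 1 ≤ k from h)
  have h2 : wl (k + 1) * m = wl (j + 1) * (q * 4 ^ (k + 1) * m) := by
    simp only [wl] at hq ⊢; rw [hq]; ring
  rw [h2, hq, sum_WW]
  have : (wl (j + 1) : ℝ) = wl j * 4 ^ (j + 1) := by simp [wl]
  push_cast
  rw [this]; field_simp

lemma geo (k : ℕ) : ∑ j ∈ Finset.range k, (1 : ℝ) / 4 ^ (j + 1) = (1 - 1 / 4 ^ k) / 3 := by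
  induction k with
  | zero => simp
  | succ k ih => rw [Finset.sum_range_succ, ih, pow_succ]; field_simp; ring

lemma sum_all (k m : ℕ) : ∑ i ∈ Finset.range (wl k), ∑ j ∈ Finset.range k,
    bInd (WW j) (wl (k + 1) * m + i) ≤ wl k * (1 / 3) := by
  rw [Finset.sum_comm, Finset.sum_congr rfl fun j hj => sum_WW' (Finset.mem_range.1 hj) m]
  have : ∀ j ∈ Finset.range k, (wl k : ℝ) / 4 ^ (j + 1) = wl k * (1 / 4 ^ (j + 1)) := by
    intro j _; ring
  rw [Finset.sum_congr rfl this, ← Finset.mul_sum, geo]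
  have : (0 : ℝ) ≤ 1 / 4 ^ k := by positivity
  apply mul_le_mul_of_nonneg_left _ (Nat.cast_nonneg _)
  linarith

lemma bInd_nonneg (A : Set ℕ) (n : ℕ) : 0 ≤ bInd A n := by
  rw [bInd_apply]; exact Set.indicator_nonneg (fun _ _ => zero_le_one) n

lemma mem_WW_window (k m i : ℕ) (hi : i < wl k) : wl (k + 1) * m + i ∈ WW k := by
  have := wl_lt k
  simp only [WW, Set.mem_ofPred_eq, Nat.mul_add_mod]
  rw [Nat.mod_eq_of_lt (by omega)]; exact hi

lemma window_even {k : ℕ} (hk : Even k) (m : ℕ) :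
    2 / 3 ≤ wavg (bInd AA) (wl (k + 1) * m) (wl k) := by
  have hp : (0 : ℝ) < wl k := by exact_mod_cast wl_pos k
  unfold wavg
  rw [le_div_iff₀ hp]
  have h1 : ∑ i ∈ Finset.range (wl k), (1 - bInd AA (wl (k + 1) * m + i)) ≤ wl k * (1 / 3) := by
    refine le_trans (Finset.sum_le_sum fun i hi => ?_) (sum_all k m)
    have hi := Finset.mem_range.1 hi
    by_cases h : ∃ j < k, wl (k + 1) * m + i ∈ WW j
    · obtain ⟨j, hj, hjm⟩ := h
      have h3 := Finset.single_le_sum (f := fun j => bInd (WW j) (wl (k + 1) * m + i))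
        (fun j _ => bInd_nonneg _ _) (Finset.mem_range.2 hj)
      simp only [bInd_mem hjm] at h3
      have := bInd_nonneg AA (wl (k + 1) * m + i)
      linarith
    · push Not at h
      have : wl (k + 1) * m + i ∈ AA := ⟨k, hk, mem_WW_window k m i hi, h⟩
      rw [bInd_mem this, sub_self]
      exact Finset.sum_nonneg fun j _ => bInd_nonneg _ _
  rw [Finset.sum_sub_distrib] at h1
  simp at h1
  linarith

lemma window_odd {k : ℕ} (hk : ¬ Even k) (m : ℕ) :
    -(1 / 3) ≤ wavg (-bInd AA) (wl (k + 1) * m) (wl k) := by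
  have hp : (0 : ℝ) < wl k := by exact_mod_cast wl_pos k
  unfold wavg
  rw [le_div_iff₀ hp]
  have h1 : ∑ i ∈ Finset.range (wl k), (bInd AA (wl (k + 1) * m + i)) ≤ wl k * (1 / 3) := by
    refine le_trans (Finset.sum_le_sum fun i hi => ?_) (sum_all k m)
    have hi := Finset.mem_range.1 hi
    by_cases h : wl (k + 1) * m + i ∈ AA
    · obtain ⟨k', hk', hm, hlt⟩ := h
      have hj : k' < k := by
        rcases lt_trichotomy k' k with h | h | h
        · exact h
        · exact absurd (h ▸ hk') hk
        · exact absurd (mem_WW_window k m i hi) (hlt k h)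
      have h3 := Finset.single_le_sum (f := fun j => bInd (WW j) (wl (k + 1) * m + i))
        (fun j _ => bInd_nonneg _ _) (Finset.mem_range.2 hj)
      simp only [bInd_mem hm] at h3
      rw [bInd_mem (show wl (k + 1) * m + i ∈ AA from ⟨k', hk', hm, hlt⟩)]
      exact h3
    · rw [bInd_not_mem h]
      exact Finset.sum_nonneg fun j _ => bInd_nonneg _ _
  simp only [BoundedContinuousFunction.coe_neg, Pi.neg_apply, Finset.sum_neg_distrib]
  linarith

/-! ### Minimal invariant filters -/

/-- Shift invariant proper filters. -/
def InvF (F : Filter ℕ) : Prop := F.NeBot ∧ ∀ A ∈ F, {n | n + 1 ∈ A} ∈ F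

lemma exists_min : ∃ F, InvF F ∧ ∀ G, InvF G → G ≤ F → F ≤ G := by
  obtain ⟨F, -, hF⟩ := @zorn_le_nonempty₀ (Filter ℕ)ᵒᵈ _ {F | InvF F} (by
    intro c hc hch y hy
    let c' : Set (Filter ℕ) := c
    have hne : c'.Nonempty := ⟨y, hy⟩
    have hdir : DirectedOn (· ≥ ·) c' := IsChain.directedOn (r := (· ≥ ·)) hch
    refine ⟨(sInf c' : Filter ℕ), ⟨?_, ?_⟩, fun z hz => sInf_le (α := Filter ℕ) hz⟩
    · refine sInf_neBot_of_directed' hne hdir fun hb => ?_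
      exact (hc hb).1.ne rfl
    · intro A hA
      rw [sInf_eq_iInf, mem_biInf_of_directed (f := fun a => a) hdir hne] at hA ⊢
      obtain ⟨f, hf, hAf⟩ := hA
      exact ⟨f, hf, (hc hf).2 A hAf⟩) (⊤ : Filter ℕ)
    ⟨inferInstance, by
      intro A hA
      rw [mem_top] at hA ⊢
      simp [hA]⟩
  exact ⟨F, hF.1, fun G hG hGF => hF.2 hG hGF⟩

lemma InvF.thick {F : Filter ℕ} (hF : InvF F) {A : Set ℕ} (hA : A ∈ F) (N : ℕ) :
    ∃ t, ∀ i < N, t + i ∈ A := by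
  have h1 : ∀ i : ℕ, {n | n + i ∈ A} ∈ F := by
    intro i
    induction i with
    | zero => simpa using hA
    | succ i ih =>
      have := hF.2 _ ih
      refine mem_of_superset this fun n hn => ?_
      simp only [Set.mem_ofPred_eq] at hn ⊢
      rwa [show n + (i + 1) = n + 1 + i by ring]
  have h2 : (⋂ i ∈ Finset.range N, {n | n + i ∈ A}) ∈ F :=
    (biInter_finset_mem _).2 fun i _ => h1 i
  have := hF.1
  obtain ⟨t, ht⟩ := nonempty_of_mem h2
  simp only [Set.mem_iInter, Finset.mem_range] at ht
  exact ⟨t, ht⟩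

lemma InvF.window {F : Filter ℕ} (hF : InvF F) {A : Set ℕ} (hA : A ∈ F) (k : ℕ) :
    ∃ m, ∀ i < wl k, wl (k + 1) * m + i ∈ A := by
  obtain ⟨t, ht⟩ := hF.thick hA (2 * wl (k + 1))
  have hlt := wl_lt k
  have hp := wl_pos (k + 1)
  refine ⟨t / wl (k + 1) + 1, fun i hi => ?_⟩
  have h1 := Nat.div_add_mod t (wl (k + 1))
  have h2 := Nat.mod_lt t hp
  have h3 := ht (wl (k + 1) - t % wl (k + 1) + i) (by omega)
  have h4 : wl (k + 1) * (t / wl (k + 1) + 1) + i = t + (wl (k + 1) - t % wl (k + 1) + i) := by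
    rw [mul_add, mul_one]; omega
  rwa [h4]

/-- Banach limits carried by a filter. -/
def KF (F : Filter ℕ) : Set ((ℕ →ᵇ ℝ) →L[ℝ] ℝ) :=
  {B | IsBanachLimitD B ∧ ∀ A ∈ F, B (bInd A) = 1}

lemma two_limits {F : Filter ℕ} (hF : InvF F) : ∃ B₁ ∈ KF F, ∃ B₂ ∈ KF F, B₁ ≠ B₂ := by
  obtain ⟨B₁, h1, h1', h1''⟩ := exists_limit F wl wl_tendsto wl_pos
    (fun s k => Even k ∧ ∃ m, s = wl (k + 1) * m) (by
      intro A hA K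
      obtain ⟨m, hm⟩ := hF.window hA (2 * K)
      exact ⟨2 * K, by omega, _, ⟨even_two_mul K, m, rfl⟩, hm⟩)
  obtain ⟨B₂, h2, h2', h2''⟩ := exists_limit F wl wl_tendsto wl_pos
    (fun s k => ¬ Even k ∧ ∃ m, s = wl (k + 1) * m) (by
      intro A hA K
      obtain ⟨m, hm⟩ := hF.window hA (2 * K + 1)
      exact ⟨2 * K + 1, by omega, _, ⟨by simp, m, rfl⟩, hm⟩)
  refine ⟨B₁, ⟨h1, h1'⟩, B₂, ⟨h2, h2'⟩, fun he => ?_⟩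
  have e1 := h1'' (bInd AA) (2 / 3) (by rintro s k ⟨hk, m, rfl⟩; exact window_even hk m)
  have e2 := h2'' (-bInd AA) (-(1 / 3)) (by rintro s k ⟨hk, m, rfl⟩; exact window_odd hk m)
  rw [map_neg] at e2
  rw [he] at e1
  linarith

lemma BL_mono {B : (ℕ →ᵇ ℝ) →L[ℝ] ℝ} (hB : IsBanachLimitD B) {x y : ℕ →ᵇ ℝ}
    (h : ∀ n, x n ≤ y n) : B x ≤ B y := by
  have := hB.1 (y - x) (fun n => by simpa using h n)
  rw [map_sub] at this; linarith

lemma BL_le_one {B : (ℕ →ᵇ ℝ) →L[ℝ] ℝ} (hB : IsBanachLimitD B) (A : Set ℕ) : B (bInd A) ≤ 1 := by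
  rw [← hB.2.1]
  refine BL_mono hB fun n => ?_
  by_cases h : n ∈ A
  · simp [bInd_mem h]
  · simp [bInd_not_mem h]

lemma BL_abs {B : (ℕ →ᵇ ℝ) →L[ℝ] ℝ} (hB : IsBanachLimitD B) (x : ℕ →ᵇ ℝ) : |B x| ≤ ‖x‖ := by
  have h1 : ∀ n, |x n| ≤ ‖x‖ := fun n => x.norm_coe_le_norm n
  have h2 : B (‖x‖ • BoundedContinuousFunction.const ℕ (1 : ℝ)) = ‖x‖ := by
    rw [map_smul, hB.2.1]; simp
  have h3 : B x ≤ B (‖x‖ • BoundedContinuousFunction.const ℕ (1 : ℝ)) :=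
    BL_mono hB fun n => by simpa using (abs_le.1 (h1 n)).2
  have h4 : B (-(‖x‖ • BoundedContinuousFunction.const ℕ (1 : ℝ))) ≤ B x :=
    BL_mono hB fun n => by simpa using (abs_le.1 (h1 n)).1
  rw [map_neg] at h4
  rw [abs_le]; constructor <;> linarith

/-- The filter of sets of full measure. -/
def filt (B : (ℕ →ᵇ ℝ) →L[ℝ] ℝ) (hB : IsBanachLimitD B) : Filter ℕ where
  sets := {A | B (bInd A) = 1}
  univ_sets := by
    have : bInd Set.univ = BoundedContinuousFunction.const ℕ (1 : ℝ) := by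
      ext n; simp [bInd_apply]
    simp only [Set.mem_ofPred_eq, this]; exact hB.2.1
  sets_of_superset := by
    intro A C hA hAC
    refine le_antisymm (BL_le_one hB C) ?_
    rw [← show B (bInd A) = 1 from hA]
    exact BL_mono hB fun n => Set.indicator_le_indicator_of_subset hAC (fun _ => zero_le_one) n
  inter_sets := by
    intro A C hA hC
    refine le_antisymm (BL_le_one hB _) ?_
    have h : B (bInd A + bInd C - BoundedContinuousFunction.const ℕ (1 : ℝ)) ≤ B (bInd (A ∩ C)) := by
      refine BL_mono hB fun n => ?_
      by_cases h1 : n ∈ A <;> by_cases h2 : n ∈ C <;> simp [bInd_apply, h1, h2]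
    rw [map_sub, map_add, hB.2.1, show B (bInd A) = 1 from hA, show B (bInd C) = 1 from hC] at h
    linarith

lemma filt_inv (B : (ℕ →ᵇ ℝ) →L[ℝ] ℝ) (hB : IsBanachLimitD B) : InvF (filt B hB) := by
  constructor
  · rw [neBot_iff]
    intro h
    have h1 : (∅ : Set ℕ) ∈ filt B hB := by rw [h]; exact mem_bot
    have h2 : B (bInd ∅) = 1 := h1
    have h3 : bInd ∅ = 0 := by ext n; simp [bInd_apply]
    rw [h3, map_zero] at h2
    exact zero_ne_one h2
  · intro A hA
    have hA : B (bInd A) = 1 := hA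
    change B (bInd _) = 1
    refine le_antisymm (BL_le_one hB _) ?_
    have h : B (bInd A) ≤ B (shiftR (bInd {n | n + 1 ∈ A}) +
        (BoundedContinuousFunction.const ℕ (1 : ℝ) -
          shiftR (BoundedContinuousFunction.const ℕ (1 : ℝ)))) := by
      refine BL_mono hB fun n => ?_
      cases n with
      | zero =>
        have : bInd A 0 ≤ 1 := by
          by_cases h : 0 ∈ A
          · simp [bInd_mem h]
          · simp [bInd_not_mem h]
        simpa [shiftR_zero] using this
      | succ n =>
        by_cases h : n + 1 ∈ A <;> simp [shiftR_succ, bInd_apply, h]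
    rw [map_add, map_sub, hB.2.2, hB.2.2, hA] at h
    linarith

lemma KF_extreme {F : Filter ℕ} {B : (ℕ →ᵇ ℝ) →L[ℝ] ℝ} (hB : B ∈ Set.extremePoints ℝ (KF F)) :
    B ∈ Set.extremePoints ℝ {B | IsBanachLimitD B} := by
  rw [mem_extremePoints] at hB ⊢
  refine ⟨hB.1.1, fun B1 h1 B2 h2 hseg => ?_⟩
  refine hB.2 B1 ⟨h1, ?_⟩ B2 ⟨h2, ?_⟩ hseg
  all_goals
    intro A hA
    obtain ⟨a, b, ha, hb, hab, rfl⟩ := hseg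
    have h := hB.1.2 A hA
    simp only [_root_.add_apply, _root_.smul_apply, smul_eq_mul] at h
    have e1 := BL_le_one h1 A
    have e2 := BL_le_one h2 A
    nlinarith

lemma KM_two {E : Type*} [NormedAddCommGroup E] [NormedSpace ℝ E] (K : Set (WeakDual ℝ E))
    (hcomp : IsCompact K) (hconv : Convex ℝ K) {B₁ B₂ : WeakDual ℝ E} (h1 : B₁ ∈ K) (h2 : B₂ ∈ K)
    (hne : B₁ ≠ B₂) : ∃ B₁ ∈ Set.extremePoints ℝ K, ∃ B₂ ∈ Set.extremePoints ℝ K, B₁ ≠ B₂ := by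
  have : LocallyConvexSpace ℝ (WeakDual ℝ E) := (WeakDual.withSeminorms ℝ E).toLocallyConvexSpace
  have hKM := closure_convexHull_extremePoints hcomp hconv
  by_contra hcon
  push Not at hcon
  have hsub : (Set.extremePoints ℝ K).Subsingleton := fun B hB C hC => hcon _ hB _ hC
  have hKs : K.Subsingleton := by
    rw [← hKM]
    rcases hsub.eq_empty_or_singleton with h | ⟨B, h⟩
    · rw [h]; simp
    · rw [h]; simp
  exact hne (hKs h1 h2)

lemma two_extreme {F : Filter ℕ} (hF : InvF F) : ∃ B₁ ∈ Set.extremePoints ℝ (KF F),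
    ∃ B₂ ∈ Set.extremePoints ℝ (KF F), B₁ ≠ B₂ := by
  let K : Set (WeakDual ℝ (ℕ →ᵇ ℝ)) := WeakDual.toStrongDual ⁻¹' (KF F)
  have hev : ∀ x : ℕ →ᵇ ℝ, Continuous fun B : WeakDual ℝ (ℕ →ᵇ ℝ) => B x :=
    fun x => WeakDual.eval_continuous x
  have hcl : IsClosed K := by
    have : K = ((⋂ x : ℕ →ᵇ ℝ, ⋂ _ : ∀ n, 0 ≤ x n, {B : WeakDual ℝ (ℕ →ᵇ ℝ) | 0 ≤ B x}) ∩
        ({B : WeakDual ℝ (ℕ →ᵇ ℝ) | B (BoundedContinuousFunction.const ℕ (1 : ℝ)) = 1} ∩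
        ⋂ x : ℕ →ᵇ ℝ, {B : WeakDual ℝ (ℕ →ᵇ ℝ) | B (shiftR x) = B x})) ∩
        ⋂ A : Set ℕ, ⋂ _ : A ∈ F, {B : WeakDual ℝ (ℕ →ᵇ ℝ) | B (bInd A) = 1} := by
      ext B
      simp only [Set.mem_inter_iff, Set.mem_iInter, Set.mem_ofPred_eq]
      rfl
    rw [this]
    refine IsClosed.inter (IsClosed.inter ?_ (IsClosed.inter ?_ ?_)) ?_
    · exact isClosed_iInter fun x => isClosed_iInter fun _ => isClosed_le continuous_const (hev x)
    · exact isClosed_eq (hev _) continuous_const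
    · exact isClosed_iInter fun x => isClosed_eq (hev _) (hev _)
    · exact isClosed_iInter fun A => isClosed_iInter fun _ => isClosed_eq (hev _) continuous_const
  have hcomp : IsCompact K := by
    refine (WeakDual.isCompact_closedBall (𝕜 := ℝ) (E := ℕ →ᵇ ℝ) 0 1).of_isClosed_subset hcl ?_
    intro B hB
    simp only [Set.mem_preimage, Metric.mem_closedBall, dist_zero_right]
    refine ContinuousLinearMap.opNorm_le_bound _ zero_le_one fun x => ?_
    rw [one_mul]
    exact BL_abs hB.1 x
  have hconv : Convex ℝ K := by
    rintro B ⟨⟨p1, p2, p3⟩, p4⟩ C ⟨⟨q1, q2, q3⟩, q4⟩ a b ha hb hab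
    have hap : ∀ x, (WeakDual.toStrongDual (a • B + b • C)) x
      = a * WeakDual.toStrongDual B x + b * WeakDual.toStrongDual C x := fun x => rfl
    refine ⟨⟨?_, ?_, ?_⟩, ?_⟩
    · intro x hx
      rw [hap]
      have := p1 x hx
      have := q1 x hx
      positivity
    · rw [hap, p2, q2]; linarith
    · intro x; rw [hap, hap, p3, q3]
    · intro A hA; rw [hap, p4 A hA, q4 A hA]; linarith
  obtain ⟨B₁, h1, B₂, h2, hne⟩ := two_limits hF
  exact KM_two K hcomp hconv h1 h2 hne

lemma key {F : Filter ℕ} (hmin : ∀ G, InvF G → G ≤ F → F ≤ G)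
    {B C : (ℕ →ᵇ ℝ) →L[ℝ] ℝ} (hB : B ∈ KF F) (hC : C ∈ KF F) {x : ℕ →ᵇ ℝ}
    (h1 : 1 ≤ B x) (h2 : C x ≤ -1) (hx : ‖x‖ ≤ 1) : False := by
  have hb : ∀ n, -1 ≤ x n ∧ x n ≤ 1 := fun n => abs_le.1 ((x.norm_coe_le_norm n).trans hx)
  let A : Set ℕ := {n | 0 < x n}
  have hBA : B (bInd A) = 1 := by
    refine le_antisymm (BL_le_one hB.1 A) (h1.trans (BL_mono hB.1 fun n => ?_))
    by_cases h : n ∈ A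
    · rw [bInd_mem h]; exact (hb n).2
    · rw [bInd_not_mem h]; exact not_lt.1 h
  have hAF : A ∈ F := hmin (filt B hB.1) (filt_inv B hB.1) (fun A hA => hB.2 A hA) hBA
  have hCA : C (bInd A) = 1 := hC.2 A hAF
  have h3 : C (bInd A) ≤ C (BoundedContinuousFunction.const ℕ (1 : ℝ) + x) := by
    refine BL_mono hC.1 fun n => ?_
    by_cases h : n ∈ A
    · have : 0 < x n := h
      rw [bInd_mem h]; simp; linarith
    · rw [bInd_not_mem h]; have := (hb n).1; simp; linarith
  rw [map_add, hC.1.2.1, hCA] at h3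
  linarith

/-- There exist two distinct extreme points `B₁, B₂` of the convex set `𝔅` of all
Banach limits such that `|B₁(x) - B₂(x)| < 2` for every `x ∈ l_∞` with `‖x‖ ≤ 1`. -/
theorem stmt_14 :
    ∃ B₁ B₂ : (ℕ →ᵇ ℝ) →L[ℝ] ℝ,
      B₁ ∈ Set.extremePoints ℝ {B | IsBanachLimitD B} ∧
      B₂ ∈ Set.extremePoints ℝ {B | IsBanachLimitD B} ∧
      B₁ ≠ B₂ ∧
      ∀ x : ℕ →ᵇ ℝ, ‖x‖ ≤ 1 → |B₁ x - B₂ x| < 2 := by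
  obtain ⟨F, hF, hmin⟩ := exists_min
  obtain ⟨B₁, h1, B₂, h2, hne⟩ := two_extreme hF
  refine ⟨B₁, B₂, KF_extreme h1, KF_extreme h2, hne, fun x hx => ?_⟩
  have a1 := abs_le.1 ((BL_abs h1.1.1 x).trans hx)
  have a2 := abs_le.1 ((BL_abs h2.1.1 x).trans hx)
  by_contra hcon
  rw [not_lt, le_abs] at hcon
  rcases hcon with h | h
  · exact key hmin h1.1 h2.1 (by linarith) (by linarith) hx
  · exact key hmin h2.1 h1.1 (by linarith) (by linarith) hx
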